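/- arXiv:1905.10560 — 3 statements merged into one kernel-verified Lean document; each statement's English description precedes it below -/
import Mathlib

section
/- Let G be a finite simple graph such that the matching complex M(G) is connected, i.e. the graph Γ on vertex set E(G) in which two edges of G are adjacent exactly when they are disjoint is connected. Then for any two edges ē, ē′ of G there is a path in Γ from ē to ē′ of length at most 4; that is, the diameter of the 1-skeleton of any connected matching complex is at most 4. -/
open SimpleGraph

/-- Two edges (as elements of `Sym2 V`) are incident if they share a vertex. -/
def EdgeIncident {V : Type*} (e f : Sym2 V) : Prop := ∃ v, v ∈ e ∧ v ∈ f

/-- The 1-skeleton of the matching complex of `G`: the graph whose vertices are the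
edges of `G`, two of them being adjacent exactly when they are disjoint (non-incident). -/
def matchingSkeleton {V : Type*} (G : SimpleGraph V) : SimpleGraph G.edgeSet :=
  SimpleGraph.fromRel fun e f => ¬ EdgeIncident e.1 f.1

theorem matchingSkeleton_adj_iff {V : Type*} {G : SimpleGraph V} {e f : G.edgeSet} :
    (matchingSkeleton G).Adj e f ↔ ¬ EdgeIncident e.1 f.1 := by
  have hsymm : EdgeIncident f.1 e.1 ↔ EdgeIncident e.1 f.1 := by
    simp only [EdgeIncident, and_comm]
  simp only [matchingSkeleton, SimpleGraph.fromRel_adj, hsymm, or_self, and_iff_right_iff_imp]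
  rintro h rfl
  exact h ⟨_, e.1.out_fst_mem, e.1.out_fst_mem⟩

theorem edgeIncident_mk {V : Type*} {a b c d : V} :
    EdgeIncident s(a, b) s(c, d) ↔ a = c ∨ a = d ∨ b = c ∨ b = d := by
  simp only [EdgeIncident, Sym2.mem_iff, or_and_right, exists_or, exists_eq_left, or_assoc]

/-- Let consecutive members of `e, g, h` be disjoint, and let `k` and `f` be disjoint.
If each of `e`, `g`, `h` meets both `f` and `k`, where `e ≠ f` and `e` is not a loop,
then `h = e`. -/
theorem Sym2.eq_of_edgeIncident {V : Type*} {e f g h k : Sym2 V} (hef : e ≠ f) (he : ¬ e.IsDiag)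
    (heg : ¬ EdgeIncident e g) (hgh : ¬ EdgeIncident g h) (hkf : ¬ EdgeIncident k f)
    (hf : EdgeIncident e f) (hek : EdgeIncident e k) (hgf : EdgeIncident g f)
    (hgk : EdgeIncident g k) (hhf : EdgeIncident h f) (hhk : EdgeIncident h k) :
    h = e := by
  induction e with | _ a b
  induction f with | _ c d
  induction g with | _ p q
  induction h with | _ r s
  induction k with | _ t u
  simp only [edgeIncident_mk, Sym2.mk_isDiag_iff, ne_eq, Sym2.eq_iff] at *
  grind

/-- If the matching complex of a finite simple graph `G` is connected,
then any two of its vertices (edges of `G`) are joined by a path of length at most 4;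
i.e. the 1-skeleton of a connected matching complex has diameter at most 4. -/
theorem matchingComplex_diameter_le_four {V : Type*} [Fintype V] (G : SimpleGraph V)
    (hconn : (matchingSkeleton G).Connected) :
    ∀ e f : G.edgeSet, (matchingSkeleton G).dist e f ≤ 4 := by
  intro e f
  by_contra! hd
  have hlen (p : (matchingSkeleton G).Walk e f) : 5 ≤ p.length :=
    hd.trans_le (SimpleGraph.dist_le p)
  have hne : e ≠ f := by
    rintro rfl
    simp at hd
  obtain ⟨p, hp⟩ := hconn.exists_walk_length_eq_dist e f
  obtain ⟨k, hfk⟩ : ∃ k, (matchingSkeleton G).Adj f k := by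
    cases p.reverse with
    | nil => exact absurd rfl hne
    | cons h _ => exact ⟨_, h⟩
  have hkf := hfk.symm
  cases p with
  | nil => exact hne rfl
  | @cons _ g _ heg p =>
    cases p with
    | nil => simpa using hlen (.cons heg .nil)
    | @cons _ h _ hgh p =>
      have hhe : h.1 ≠ e.1 := by
        intro H
        obtain rfl := Subtype.ext H
        have := SimpleGraph.dist_le p
        simp only [SimpleGraph.Walk.length_cons] at hp
        omega
      refine hhe (Sym2.eq_of_edgeIncident (fun H => hne (Subtype.ext H))
        (G.not_isDiag_of_mem_edgeSet e.2) (matchingSkeleton_adj_iff.1 heg)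
        (matchingSkeleton_adj_iff.1 hgh) (matchingSkeleton_adj_iff.1 hkf) ?_ ?_ ?_ ?_ ?_ ?_) <;>
      refine not_not.1 fun H => ?_ <;>
      have H := matchingSkeleton_adj_iff.2 H
      · simpa using hlen (.cons H .nil)
      · simpa using hlen (.cons H (.cons hkf .nil))
      · simpa using hlen (.cons heg (.cons H .nil))
      · simpa using hlen (.cons heg (.cons H (.cons hkf .nil)))
      · simpa using hlen (.cons heg (.cons hgh (.cons H .nil)))
      · simpa using hlen (.cons heg (.cons hgh (.cons H (.cons hkf .nil))))
end

section
/- Let G be a finite simple graph that has at least two incident edges, and suppose there is no pair of edges ē, ē′ of G such that every edge in E(G) ∖ {ē, ē′} is incident to ē or to ē′. Then the 1-skeleton of the matching complex M(G) — the graph whose vertices are the edges of G, two being adjacent exactly when the corresponding edges are disjoint — is connected and has diameter exactly 2. -/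
open SimpleGraph

theorem EdgeIncident.symm {V : Type*} {e f : Sym2 V} (h : EdgeIncident e f) :
    EdgeIncident f e :=
  let ⟨v, he, hf⟩ := h
  ⟨v, hf, he⟩

theorem matchingSkeleton_adj {V : Type*} {G : SimpleGraph V} {e f : G.edgeSet} :
    (matchingSkeleton G).Adj e f ↔ e ≠ f ∧ ¬ EdgeIncident e.1 f.1 := by
  rw [matchingSkeleton, SimpleGraph.fromRel_adj]
  exact and_congr_right fun _ =>
    ⟨fun h => h.elim id fun h' hi => h' hi.symm, Or.inl⟩

/-- If no two edges dominate all others, any two edges are joined by a walk of length two in the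
1-skeleton of the matching complex. -/
theorem matchingSkeleton_exists_walk_length_two {V : Type*} {G : SimpleGraph V}
    (hno : ¬ ∃ e e' : Sym2 V, e ∈ G.edgeSet ∧ e' ∈ G.edgeSet ∧
      ∀ g ∈ G.edgeSet, g ≠ e → g ≠ e' → EdgeIncident g e ∨ EdgeIncident g e')
    (e f : G.edgeSet) : ∃ p : (matchingSkeleton G).Walk e f, p.length = 2 := by
  by_contra! hp
  refine hno ⟨e, f, e.2, f.2, fun g hg hge hgf => ?_⟩
  by_contra! hi
  have hadj_e : (matchingSkeleton G).Adj e ⟨g, hg⟩ :=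
    matchingSkeleton_adj.2 ⟨fun h => hge (congrArg Subtype.val h).symm, fun h => hi.1 h.symm⟩
  have hadj_f : (matchingSkeleton G).Adj ⟨g, hg⟩ f :=
    matchingSkeleton_adj.2 ⟨fun h => hgf (congrArg Subtype.val h), hi.2⟩
  exact hp (.cons hadj_e (.cons hadj_f .nil)) rfl

/-- If a finite simple graph `G` has at least two (distinct) incident
edges, but no pair of edges `ē, ē′` such that every edge outside `{ē, ē′}` is incident
to `ē` or to `ē′`, then the 1-skeleton of the matching complex `M(G)` is connected and
has diameter exactly 2. -/
theorem matchingComplex_diameter_eq_two {V : Type*} [Fintype V] (G : SimpleGraph V)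
    (h2 : ∃ e f : Sym2 V, e ∈ G.edgeSet ∧ f ∈ G.edgeSet ∧ e ≠ f ∧ EdgeIncident e f)
    (hno : ¬ ∃ e e' : Sym2 V, e ∈ G.edgeSet ∧ e' ∈ G.edgeSet ∧
      ∀ g ∈ G.edgeSet, g ≠ e → g ≠ e' → EdgeIncident g e ∨ EdgeIncident g e') :
    (matchingSkeleton G).Connected ∧
      (∀ e f : G.edgeSet, (matchingSkeleton G).dist e f ≤ 2) ∧
      (∃ e f : G.edgeSet, (matchingSkeleton G).dist e f = 2) := by
  have hwalk := matchingSkeleton_exists_walk_length_two hno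
  obtain ⟨e, f, he, hf, hne, hinc⟩ := h2
  have hconn : (matchingSkeleton G).Connected :=
    { preconnected := fun a b => ⟨(hwalk a b).choose⟩
      nonempty := ⟨⟨e, he⟩⟩ }
  have hle (a b : G.edgeSet) : (matchingSkeleton G).dist a b ≤ 2 := by
    obtain ⟨p, hp⟩ := hwalk a b
    exact hp ▸ SimpleGraph.dist_le p
  refine ⟨hconn, hle, ⟨e, he⟩, ⟨f, hf⟩, ?_⟩
  have h0 : (matchingSkeleton G).dist ⟨e, he⟩ ⟨f, hf⟩ ≠ 0 := fun h =>
    hne (congrArg Subtype.val (hconn.dist_eq_zero_iff.1 h))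
  have h1 : (matchingSkeleton G).dist ⟨e, he⟩ ⟨f, hf⟩ ≠ 1 := fun h =>
    (matchingSkeleton_adj.1 (SimpleGraph.dist_eq_one_iff_adj.1 h)).2 hinc
  have := hle ⟨e, he⟩ ⟨f, hf⟩
  omega
end

section
/- Let G be an r × s × t honeycomb graph (r, s, t ≥ 1). Then the matching complex M(G) is at least k-connected, where k = t·⌈(r+s−1)/2⌉ + ⌈(max(r,s)·min(r,s))/2⌉ − 2. -/
open SimpleGraph

/-- The matching complex of a graph, as the set of its faces:
finite sets of pairwise non-incident edges of `G`. -/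
def matchingComplex {V : Type*} (G : SimpleGraph V) : Set (Finset (Sym2 V)) :=
  {m | (∀ e ∈ m, e ∈ G.edgeSet) ∧
    (m : Set (Sym2 V)).Pairwise fun e f => ¬ EdgeIncident e f}

/-- The geometric realization of an abstract simplicial complex, given as a
downward-closed set of finite subsets of the vertex type `α`. -/
abbrev Realization {α : Type*} (K : Set (Finset α)) : Type _ :=
  { f : α → ℝ // (∀ a, 0 ≤ f a) ∧
      ∃ s ∈ K, (∀ a, f a ≠ 0 → a ∈ s) ∧ ∑ a ∈ s, f a = 1 }

/-- A space `X` is `n`-connected if it is nonempty and all homotopy groups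
`π_ℓ` vanish for `ℓ ≤ n`. -/
def IsNConnectedSpace (n : ℕ) (X : Type*) [TopologicalSpace X] : Prop :=
  Nonempty X ∧ ∀ ℓ : ℕ, ℓ ≤ n → ∀ x : X, Subsingleton (HomotopyGroup (Fin ℓ) X x)

/-- The number `ρ(i)` of hexagons in the `i`-th row from the top of the
`r × s × t` honeycomb graph. -/
def honeycombRho (r s t i : ℕ) : ℕ :=
  if i ≤ min r s then t + i - 1
  else if i ≤ max r s then t + min r s - 1
  else t + r + s - 1 - i

/-- The horizontal (brick-wall) offset of the `i`-th row of hexagons of the honeycomb: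
the row shifts left while the upper-left side (of length `s`) slopes outward, and right
afterwards. -/
def honeycombOffset (s i : ℕ) : ℤ := (i : ℤ) + 1 - 2 * (min i s : ℤ)

/-- The six edges of the unit hexagon whose lower-left vertex is at `(x, y)` in
brick-wall coordinates: horizontal edges `(x,y)–(x+1,y)–(x+2,y)` and
`(x,y+1)–(x+1,y+1)–(x+2,y+1)`, and vertical edges `(x,y)–(x,y+1)`, `(x+2,y)–(x+2,y+1)`. -/
def HexEdge (x y : ℤ) (p q : ℤ × ℤ) : Prop :=
  (p = (x, y) ∧ q = (x + 1, y)) ∨ (p = (x + 1, y) ∧ q = (x + 2, y)) ∨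
  (p = (x, y + 1) ∧ q = (x + 1, y + 1)) ∨ (p = (x + 1, y + 1) ∧ q = (x + 2, y + 1)) ∨
  (p = (x, y) ∧ q = (x, y + 1)) ∨ (p = (x + 2, y) ∧ q = (x + 2, y + 1))

/-- The `r × s × t` honeycomb graph, realized in brick-wall coordinates on `ℤ × ℤ`:
the union of the hexagons of rows `i = 1, …, r + s − 1`, where row `i` (at height
`r + s − 1 − i`) consists of `ρ(i)` hexagons starting at horizontal offset
`honeycombOffset s i`, consecutive hexagons of a row being `2` apart. -/
def honeycomb (r s t : ℕ) : SimpleGraph (ℤ × ℤ) :=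
  SimpleGraph.fromRel fun p q =>
    ∃ i j : ℕ, 1 ≤ i ∧ i ≤ r + s - 1 ∧ j < honeycombRho r s t i ∧
      HexEdge (honeycombOffset s i + 2 * (j : ℤ)) ((r : ℤ) + (s : ℤ) - 1 - (i : ℤ)) p q

open scoped unitInterval Topology in
/-- A generalized loop which deforms to a point through maps that are constant on the boundary
of the cube is null-homotopic relative to the boundary. -/
theorem GenLoop.homotopic_const_of_deformation {ℓ : ℕ} {X Z : Type*} [TopologicalSpace X]
    [TopologicalSpace Z] {x₀ q : X} (f : GenLoop (Fin ℓ) X x₀) (h : Z × I → X)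
    (hh : Continuous h) (g : (I^ Fin ℓ) → Z) (hg : Continuous g) (z₀ : Z)
    (h0 : ∀ y, h (g y, 0) = f y) (hz₀ : h (z₀, 0) = x₀)
    (hb : ∀ y ∈ Cube.boundary (Fin ℓ), g y = z₀) (h1 : ∀ z, h (z, 1) = q) :
    GenLoop.Homotopic f GenLoop.const := by
  set n : (I^ Fin ℓ) → ℝ := fun y => ‖fun i => 2 * (y i : ℝ) - 1‖ with hn
  have hnc : Continuous n := by fun_prop
  let clamp : ℝ → I := Set.projIcc 0 1 zero_le_one
  have hclamp : Continuous clamp := continuous_projIcc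
  have hn1 : ∀ y ∈ Cube.boundary (Fin ℓ), 1 ≤ n y := by
    rintro y ⟨i, hi⟩
    refine le_trans ?_ (norm_le_pi_norm (fun i => 2 * (y i : ℝ) - 1) i)
    rcases hi with hi | hi <;> (simp [hi]; try norm_num)
  have clamp_eq_zero : ∀ a : ℝ, a ≤ 0 → clamp a = 0 := fun a ha => Set.projIcc_of_le_left _ ha
  have clamp_eq_one : ∀ a : ℝ, 1 ≤ a → clamp a = 1 := fun a ha => Set.projIcc_of_right_le _ ha
  let dil : I × (I^ Fin ℓ) → (I^ Fin ℓ) := fun p i =>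
    clamp (1 / 2 + (1 + (p.1 : ℝ)) * ((p.2 i : ℝ) - 1 / 2))
  have hdil : Continuous dil := by fun_prop
  let τ : I × (I^ Fin ℓ) → I := fun p => clamp (min (p.1 : ℝ) (2 * (1 - n p.2)))
  have hτ : Continuous τ := by fun_prop
  let G : C(I^ Fin ℓ, X) := ⟨fun y => h (z₀, τ (1, y)), by fun_prop⟩
  have hτb : ∀ t, ∀ y ∈ Cube.boundary (Fin ℓ), τ (t, y) = 0 := fun t y hy =>
    clamp_eq_zero _ ((min_le_right _ _).trans (by linarith [hn1 y hy]))
  have hdb : ∀ t, ∀ y ∈ Cube.boundary (Fin ℓ), dil (t, y) ∈ Cube.boundary (Fin ℓ) := by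
    rintro t y ⟨i, hi⟩
    have := t.2.1
    refine ⟨i, hi.imp (fun hi => clamp_eq_zero _ ?_) (fun hi => clamp_eq_one _ ?_)⟩ <;>
      simp only [hi, Set.Icc.coe_zero, Set.Icc.coe_one] <;> linarith
  have H₁ : f.1.HomotopicRel G (Cube.boundary (Fin ℓ)) := by
    refine ⟨⟨⟨⟨fun p => h (g (dil p), τ p), by fun_prop⟩, ?_, ?_⟩, ?_⟩⟩
    · intro y
      have hd : dil (0, y) = y := by
        funext i
        have : (1 / 2 + (1 + ((0 : I) : ℝ)) * ((y i : ℝ) - 1 / 2)) = y i := by simp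
        simp only [dil, this]
        exact Set.projIcc_val _ _
      have ht : τ (0, y) = 0 := clamp_eq_zero _ (min_le_left _ _)
      simp only [hd, ht]
      exact h0 y
    · intro y
      show h (g (dil (1, y)), τ (1, y)) = h (z₀, τ (1, y))
      by_cases hy : n y < 1 / 2
      · have : τ (1, y) = 1 := clamp_eq_one _ (le_min (by simp) (by linarith))
        rw [this, h1, h1]
      · rw [hb]
        simp only [hn, pi_norm_lt_iff (show (0 : ℝ) < 1 / 2 by norm_num), not_forall, not_lt,
          Real.norm_eq_abs, le_abs] at hy
        obtain ⟨i, hi⟩ := hy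
        refine ⟨i, hi.symm.imp (fun hi => clamp_eq_zero _ ?_) (fun hi => clamp_eq_one _ ?_)⟩ <;>
          simp only [Set.Icc.coe_one] <;> linarith
    · intro t y hy
      show h (g (dil (t, y)), τ (t, y)) = f y
      rw [hb _ (hdb t y hy), hτb t y hy, hz₀]
      exact (f.2 y hy).symm
  have H₂ : G.HomotopicRel (GenLoop.const (N := Fin ℓ) (x := x₀)).1 (Cube.boundary (Fin ℓ)) := by
    refine ⟨⟨⟨⟨fun p => h (z₀, unitInterval.symm p.1 * τ (1, p.2)), by fun_prop⟩, ?_, ?_⟩, ?_⟩⟩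
    · intro y
      simp [G]
    · intro y
      simp [hz₀, GenLoop.const]
    · intro t y hy
      simp [G, hτb 1 y hy]
  exact H₁.trans H₂

open scoped unitInterval Topology in
/-- A map from an `ℓ`-cube to a Euclidean space of larger dimension can be dodged by a map to the
small cube `[0, δ]^κ` which is constant on a prescribed fibre. -/
theorem exists_continuous_ne_of_lt_card {ℓ : ℕ} {κ : Type*} [Fintype κ] (hκ : ℓ < Fintype.card κ)
    (γ : (I^ Fin ℓ) → κ → ℝ) (hγ : Continuous γ) (g₀ : κ → ℝ) {δ : ℝ} (hδ : 0 < δ) :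
    ∃ (c : (I^ Fin ℓ) → κ → ℝ) (c₀ : κ → ℝ), Continuous c ∧ (∀ y, c y ≠ γ y) ∧ c₀ ≠ g₀ ∧
      (∀ y, γ y = g₀ → c y = c₀) ∧ (∀ y j, 0 ≤ c y j ∧ c y j ≤ δ) ∧
      ∀ j, 0 ≤ c₀ j ∧ c₀ j ≤ δ := by
  have : Nonempty κ := Fintype.card_pos_iff.1 (by lia)
  obtain ⟨b₀, hb₀, hb₀'⟩ : ∃ b₀ : κ → ℝ, b₀ ≠ g₀ ∧ ∀ j, δ / 3 ≤ b₀ j ∧ b₀ j ≤ 2 * δ / 3 := by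
    by_cases hc : (fun _ => δ / 3) = g₀
    · refine ⟨fun _ => 2 * δ / 3, ?_, fun j => ⟨by linarith, le_rfl⟩⟩
      intro hc'
      have := congrFun (hc.trans hc'.symm) (Classical.arbitrary κ)
      linarith
    · exact ⟨_, hc, fun j => ⟨le_rfl, by linarith⟩⟩
  have hR : 0 < dist b₀ g₀ := dist_pos.2 hb₀
  obtain ⟨ε, hε, hεR, hεδ⟩ : ∃ ε > 0, 4 * ε ≤ dist b₀ g₀ ∧ 6 * ε ≤ δ :=
    ⟨min (dist b₀ g₀ / 4) (δ / 6), by positivity, by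
      linarith [min_le_left (dist b₀ g₀ / 4) (δ / 6)], by
      linarith [min_le_right (dist b₀ g₀ / 4) (δ / 6)]⟩
  let proj : (Fin ℓ → ℝ) → (I^ Fin ℓ) := fun z i => Set.projIcc 0 1 zero_le_one (z i)
  have hproj : Continuous proj := continuous_pi fun i => continuous_projIcc.comp (by fun_prop)
  obtain ⟨p, hp, hpγ, -⟩ := (hγ.comp hproj).exists_contDiff_approx (ε := fun _ => ε) 1
    continuous_const fun _ => hε
  have hdense := ContDiff.dense_compl_range_of_finrank_lt_finrank (f := p) (by simpa using hp)
    (by simpa using hκ)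
  obtain ⟨b, hb, hbb₀⟩ := hdense.exists_dist_lt b₀ hε
  let P : (I^ Fin ℓ) → κ → ℝ := fun y => p fun i => y i
  have hP : Continuous P := hp.continuous.comp (by fun_prop)
  have hPγ : ∀ y, ‖γ y - P y‖ < ε := by
    intro y
    have h := hpγ fun i => y i
    have hy : proj (fun i => y i) = y := funext fun i => Set.projIcc_val _ _
    rwa [Function.comp_apply, hy, _root_.dist_comm, dist_eq_norm] at h
  have hPb : ∀ y, P y ≠ b := fun y hy => hb ⟨_, hy⟩
  let θ : (I^ Fin ℓ) → ℝ := fun y => min 1 (dist (γ y) g₀ / ε)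
  have hθ : ∀ y, 0 ≤ θ y ∧ θ y ≤ 1 := fun y => ⟨by positivity, min_le_left _ _⟩
  have hsmall : ∀ y, ‖θ y • (γ y - P y)‖ ≤ ε := by
    intro y
    rw [norm_smul, Real.norm_eq_abs, abs_of_nonneg (hθ y).1]
    nlinarith [hθ y, hPγ y, norm_nonneg (γ y - P y)]
  have hbounds : ∀ w : κ → ℝ, ‖w‖ ≤ ε → ∀ j, 0 ≤ (b + w) j ∧ (b + w) j ≤ δ := by
    intro w hw j
    have h1 := (norm_le_pi_norm w j).trans hw
    have h2 := (dist_le_pi_dist b₀ b j).trans hbb₀.le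
    rw [Real.norm_eq_abs, abs_le] at h1
    rw [Real.dist_eq, abs_le] at h2
    rw [Pi.add_apply]
    constructor <;> linarith [hb₀' j]
  refine ⟨fun y => b + θ y • (γ y - P y), b, by fun_prop, ?_, ?_, ?_,
    fun y => hbounds _ (hsmall y), fun j => by simpa using hbounds 0 (by simpa using hε.le) j⟩
  · intro y hy
    rcases le_or_gt 1 (dist (γ y) g₀ / ε) with h | h
    · simp only [θ, min_eq_left h, one_smul] at hy
      apply hPb y
      have : b - P y = 0 := by linear_combination (exp := 1) hy
      exact (sub_eq_zero.1 this).symm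
    · rw [div_lt_one hε] at h
      have h1 : dist b (γ y) ≤ ε := by
        nth_rw 1 [← hy]
        simpa [dist_eq_norm] using hsmall y
      linarith [dist_triangle b₀ b g₀, dist_triangle b (γ y) g₀]
  · rintro rfl
    linarith
  · intro y hy
    simp [θ, hy]

/-- Rescaling a nonnegative function supported in a face gives a point of the realization. -/
theorem div_sum_mem_realization {α : Type*} {K : Set (Finset α)} {E s : Finset α} {w : α → ℝ}
    (hw : ∀ a, 0 ≤ w a) (hs : s ∈ K) (hsE : s ⊆ E) (hws : ∀ a, w a ≠ 0 → a ∈ s)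
    (hpos : ∃ a, 0 < w a) :
    (∀ a, 0 ≤ w a / ∑ b ∈ E, w b) ∧
      ∃ s ∈ K, (∀ a, w a / ∑ b ∈ E, w b ≠ 0 → a ∈ s) ∧ ∑ a ∈ s, w a / ∑ b ∈ E, w b = 1 := by
  obtain ⟨a, ha⟩ := hpos
  have hE : 0 < ∑ b ∈ E, w b :=
    Finset.sum_pos' (fun b _ => hw b) ⟨a, hsE (hws a ha.ne'), ha⟩
  refine ⟨fun a => div_nonneg (hw a) hE.le, s, hs, fun b hb => hws b fun h => hb (by simp [h]), ?_⟩
  rw [← Finset.sum_div, Finset.sum_subset hsE fun b _ hb => by_contra fun h => hb (hws b h),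
    div_self hE.ne']

theorem Realization.sum_eq_one {α : Type*} {K : Set (Finset α)} {E : Finset α}
    (hE : ∀ s ∈ K, s ⊆ E) (x : Realization K) : ∑ a ∈ E, x.1 a = 1 := by
  obtain ⟨-, s, hs, hxs, h1⟩ := x.2
  exact (Finset.sum_subset (hE s hs) fun b _ hb => by_contra fun h => hb (hxs b h)).symm.trans h1

section BlockMass

variable {α ι : Type*} [DecidableEq ι] (E : Finset α) (π : α → ι)

/-- The total weight that `x` gives to the elements of `E` in the block `i`. -/
def blockMass (x : α → ℝ) (i : ι) : ℝ := ∑ a ∈ E with π a = i, x a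

@[fun_prop]
theorem continuous_blockMass {Y : Type*} [TopologicalSpace Y] {x : Y → α → ℝ}
    (hx : Continuous x) (i : ι) : Continuous fun y => blockMass E π (x y) i := by
  unfold blockMass
  fun_prop

theorem sum_blockMass [Fintype ι] (x : α → ℝ) : ∑ i, blockMass E π x i = ∑ a ∈ E, x a :=
  Finset.sum_fiberwise E π x

/-- The unnormalized deformation which moves `x` first to its part in the blocks whose mass exceeds
`c`, then to the vertices `v i` of the blocks whose mass is less than `c i`, and finally to
`v i₀`. -/
noncomputable def blockTrack [DecidableEq α] [Fintype ι] (v : ι → α) (i₀ : ι) (x : α → ℝ)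
    (c : ι → ℝ) (t : ℝ) (a : α) : ℝ :=
  max (1 - 3 * t) 0 * x a +
  max (1 - |3 * t - 1|) 0 * (x a * max (∑ i, if π a = i then blockMass E π x i - c i else 0) 0) +
  max (1 - |3 * t - 2|) 0 * (∑ i, if v i = a then max (c i - blockMass E π x i) 0 else 0) +
  max (3 * t - 2) 0 * (if v i₀ = a then 1 else 0)

theorem continuous_blockTrack [DecidableEq α] [Fintype ι] (v : ι → α) (i₀ : ι) {Y : Type*}
    [TopologicalSpace Y] {x : Y → α → ℝ} {c : Y → ι → ℝ} {t : Y → ℝ} (hx : Continuous x)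
    (hc : Continuous c) (ht : Continuous t) :
    Continuous fun y => blockTrack E π v i₀ (x y) (c y) (t y) := by
  refine continuous_pi fun a => ?_
  have h1 : Continuous fun y => ∑ i, if π a = i then blockMass E π (x y) i - c y i else 0 :=
    continuous_finsetSum _ fun i _ => by split_ifs <;> fun_prop
  have h2 : Continuous fun y => ∑ i, if v i = a then max (c y i - blockMass E π (x y) i) 0 else 0 :=
    continuous_finsetSum _ fun i _ => by split_ifs <;> fun_prop
  unfold blockTrack
  fun_prop

end BlockMass

section BlockConnected

variable {α ι : Type*} [DecidableEq α] [DecidableEq ι] [Fintype ι] {K : Set (Finset α)}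
  {E : Finset α} {π : α → ι} {v : ι → α}

theorem blockTrack_mem_realization (hE : ∀ s ∈ K, s ⊆ E)
    (hK : ∀ s ∈ K, ∀ s' ⊆ s, ∀ A : Finset ι, (∀ a ∈ s', π a ∉ A) → s' ∪ A.image v ∈ K)
    (i₀ : ι) (x : Realization K) {c : ι → ℝ} (hc : ∀ i, 0 ≤ c i)
    (hlt : ∃ i, c i < blockMass E π x.1 i) (hgt : ∃ i, blockMass E π x.1 i < c i)
    (t : unitInterval) :
    (∀ a, 0 ≤ blockTrack E π v i₀ x.1 c t a / ∑ b ∈ E, blockTrack E π v i₀ x.1 c t b) ∧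
      ∃ s ∈ K,
        (∀ a, blockTrack E π v i₀ x.1 c t a / ∑ b ∈ E, blockTrack E π v i₀ x.1 c t b ≠ 0 → a ∈ s) ∧
        ∑ a ∈ s, blockTrack E π v i₀ x.1 c t a / ∑ b ∈ E, blockTrack E π v i₀ x.1 c t b = 1 := by
  obtain ⟨hx0, s, hs, hxs, -⟩ := x.2
  set T : α → ℝ := fun a =>
    x.1 a * max (∑ i, if π a = i then blockMass E π x.1 i - c i else 0) 0 with hT
  set ψ : α → ℝ := fun a => ∑ i, if v i = a then max (c i - blockMass E π x.1 i) 0 else 0 with hψ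
  have hT0 : ∀ a, 0 ≤ T a := fun a => mul_nonneg (hx0 a) (le_max_right _ _)
  have hψ0 : ∀ a, 0 ≤ ψ a := fun a => Finset.sum_nonneg fun i _ => by split_ifs <;> positivity
  have htrack : ∀ a, blockTrack E π v i₀ x.1 c t a = max (1 - 3 * (t : ℝ)) 0 * x.1 a +
      max (1 - |3 * (t : ℝ) - 1|) 0 * T a + max (1 - |3 * (t : ℝ) - 2|) 0 * ψ a +
      max (3 * (t : ℝ) - 2) 0 * (if v i₀ = a then 1 else 0) := fun a => rfl
  have hTx : ∀ a, T a ≠ 0 → x.1 a ≠ 0 := fun a ha h => ha (by simp [hT, h])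
  have hTc : ∀ a, T a ≠ 0 → c (π a) < blockMass E π x.1 (π a) := by
    intro a ha
    by_contra! h
    exact ha (by simp [hT, h])
  have hψc : ∀ a, ψ a ≠ 0 → ∃ i, v i = a ∧ blockMass E π x.1 i < c i := by
    intro a ha
    obtain ⟨i, -, hi⟩ := Finset.exists_ne_zero_of_sum_ne_zero ha
    have hv : v i = a := by_contra fun h => hi (if_neg h)
    rw [if_pos hv] at hi
    exact ⟨i, hv, by by_contra! h; exact hi (max_eq_right (by linarith))⟩
  obtain ⟨a₁, ha₁⟩ : ∃ a, 0 < T a := by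
    obtain ⟨i, hi⟩ := hlt
    have : blockMass E π x.1 i ≠ 0 := ((hc i).trans_lt hi).ne'
    obtain ⟨a, ha, hxa⟩ := Finset.exists_ne_zero_of_sum_ne_zero this
    refine ⟨a, mul_pos ((hx0 a).lt_of_ne' hxa) ?_⟩
    simpa [(Finset.mem_filter.1 ha).2] using hi
  obtain ⟨a₂, ha₂⟩ : ∃ a, 0 < ψ a := by
    obtain ⟨i, hi⟩ := hgt
    refine ⟨v i, Finset.sum_pos' (fun j _ => by split_ifs <;> positivity)
      ⟨i, Finset.mem_univ _, ?_⟩⟩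
    simpa using hi
  have hnonneg : ∀ a, 0 ≤ blockTrack E π v i₀ x.1 c t a := by
    intro a
    rw [htrack]
    have h1 := hx0 a
    have h2 := hT0 a
    have h3 := hψ0 a
    split_ifs <;> positivity
  have key : ∀ s ∈ K, (∀ a, blockTrack E π v i₀ x.1 c t a ≠ 0 → a ∈ s) →
      (∃ a, 0 < blockTrack E π v i₀ x.1 c t a) → _ := fun s hs h1 h2 =>
    div_sum_mem_realization (K := K) hnonneg hs (hE s hs) h1 h2
  rcases le_total (t : ℝ) (1 / 3) with h | h
  · have e1 : max (1 - 3 * (t : ℝ)) 0 = 1 - 3 * t := max_eq_left (by linarith)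
    have e2 : max (1 - |3 * (t : ℝ) - 1|) 0 = 3 * t := by
      rw [abs_of_nonpos (by linarith), max_eq_left] <;> linarith [t.2.1]
    have e3 : max (1 - |3 * (t : ℝ) - 2|) 0 = 0 := by
      rw [abs_of_nonpos (by linarith), max_eq_right]; linarith
    have e4 : max (3 * (t : ℝ) - 2) 0 = 0 := max_eq_right (by linarith)
    simp only [e1, e2, e3, e4, zero_mul, add_zero] at htrack
    refine key s hs (fun a ha => hxs a fun h => ha ?_) ⟨a₁, ?_⟩
    · rw [htrack, h, (by_contra fun h' => hTx a h' h : T a = 0)]; simp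
    · rw [htrack]
      have h1 := (hx0 a₁).lt_of_ne' (hTx a₁ ha₁.ne')
      nlinarith [mul_nonneg t.2.1 ha₁.le, mul_nonneg (by linarith : 0 ≤ 1 - 3 * (t : ℝ)) h1.le]
  rcases le_total (t : ℝ) (2 / 3) with h' | h'
  · have e1 : max (1 - 3 * (t : ℝ)) 0 = 0 := max_eq_right (by linarith)
    have e2 : max (1 - |3 * (t : ℝ) - 1|) 0 = 2 - 3 * t := by
      rw [abs_of_nonneg (by linarith), max_eq_left] <;> linarith
    have e3 : max (1 - |3 * (t : ℝ) - 2|) 0 = 3 * t - 1 := by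
      rw [abs_of_nonpos (by linarith), max_eq_left] <;> linarith
    have e4 : max (3 * (t : ℝ) - 2) 0 = 0 := max_eq_right (by linarith)
    simp only [e1, e2, e3, e4, zero_mul, add_zero, zero_add] at htrack
    refine key _ (hK s hs {a ∈ s | T a ≠ 0} (Finset.filter_subset _ _)
      {i | blockMass E π x.1 i < c i} ?_) (fun a ha => ?_) ?_
    · intro a ha
      simpa using (hTc a (Finset.mem_filter.1 ha).2).le
    · by_cases hTa : T a = 0
      · obtain ⟨i, hi, hi'⟩ := hψc a fun h => ha (by rw [htrack, hTa, h]; simp)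
        exact Finset.mem_union_right _ (Finset.mem_image.2 ⟨i, by simpa using hi', hi⟩)
      · exact Finset.mem_union_left _ (Finset.mem_filter.2 ⟨hxs a (hTx a hTa), hTa⟩)
    · rcases h'.lt_or_eq with h'' | h''
      · refine ⟨a₁, ?_⟩
        rw [htrack]
        have := mul_pos (by linarith : 0 < 2 - 3 * (t : ℝ)) ha₁
        have := mul_nonneg (by linarith : 0 ≤ 3 * (t : ℝ) - 1) (hψ0 a₁)
        linarith
      · exact ⟨a₂, by rw [htrack, h'']; linarith⟩
  · have e1 : max (1 - 3 * (t : ℝ)) 0 = 0 := max_eq_right (by linarith)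
    have e2 : max (1 - |3 * (t : ℝ) - 1|) 0 = 0 := by
      rw [abs_of_nonneg (by linarith), max_eq_right]; linarith
    have e3 : max (1 - |3 * (t : ℝ) - 2|) 0 = 3 - 3 * t := by
      rw [abs_of_nonneg (by linarith), max_eq_left] <;> linarith [t.2.2]
    have e4 : max (3 * (t : ℝ) - 2) 0 = 3 * t - 2 := max_eq_left (by linarith)
    simp only [e1, e2, e3, e4, zero_mul, zero_add] at htrack
    refine key _ (hK s hs ∅ (by simp) Finset.univ (by simp)) (fun a ha => ?_) ?_
    · refine Finset.mem_union_right _ ?_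
      by_cases hψa : ψ a = 0
      · by_cases hv : v i₀ = a
        · exact Finset.mem_image.2 ⟨i₀, Finset.mem_univ _, hv⟩
        · exact absurd (by rw [htrack, hψa, if_neg hv]; simp) ha
      · obtain ⟨i, hi, -⟩ := hψc a hψa
        exact Finset.mem_image.2 ⟨i, Finset.mem_univ _, hi⟩
    · rcases t.2.2.lt_or_eq with h'' | h''
      · refine ⟨a₂, ?_⟩
        rw [htrack]
        have := mul_pos (by linarith : 0 < 3 - 3 * (t : ℝ)) ha₂
        have : 0 ≤ (3 * (t : ℝ) - 2) * (if v i₀ = a₂ then 1 else 0) :=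
          mul_nonneg (by linarith) (by split_ifs <;> norm_num)
        linarith
      · refine ⟨v i₀, ?_⟩
        rw [htrack, h'', if_pos rfl]
        norm_num

/-- If the vertices of a finite simplicial complex can be divided into `n + 2` blocks, each with a
vertex `v i`, so that a face may always be enlarged by the vertices `v i` of the blocks it misses,
then the complex is `n`-connected. -/
theorem isNConnectedSpace_realization_of_blocks (hne : ∅ ∈ K) (hE : ∀ s ∈ K, s ⊆ E)
    (hK : ∀ s ∈ K, ∀ s' ⊆ s, ∀ A : Finset ι, (∀ a ∈ s', π a ∉ A) → s' ∪ A.image v ∈ K)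
    {n : ℕ} (hn : n + 2 ≤ Fintype.card ι) : IsNConnectedSpace n (Realization K) := by
  have : Nonempty ι := Fintype.card_pos_iff.1 (by lia)
  obtain i₀ : ι := Classical.arbitrary ι
  let κ := {i : ι // i ≠ i₀}
  have hκ : n < Fintype.card κ := by
    have := Fintype.card_subtype_compl fun i => i = i₀
    rw [Fintype.card_subtype_eq] at this
    lia
  have hκpos : (0 : ℝ) < Fintype.card κ := by exact_mod_cast (Nat.zero_le n).trans_lt hκ
  let Z := {p : Realization K × (ι → ℝ) // (∀ i, 0 ≤ p.2 i) ∧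
    (∃ i, p.2 i < blockMass E π p.1.1 i) ∧ ∃ i, blockMass E π p.1.1 i < p.2 i}
  let h : Z × unitInterval → Realization K := fun p =>
    ⟨_, blockTrack_mem_realization (v := v) hE hK i₀ p.1.1.1 p.1.2.1 p.1.2.2.1 p.1.2.2.2 p.2⟩
  have hcont : Continuous h := by
    have htr : Continuous fun p : Z × unitInterval =>
        blockTrack E π v i₀ p.1.1.1.1 p.1.1.2 (p.2 : ℝ) :=
      continuous_blockTrack E π v i₀
        (continuous_subtype_val.comp (continuous_fst.comp
          (continuous_subtype_val.comp continuous_fst)))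
        (continuous_snd.comp (continuous_subtype_val.comp continuous_fst)) (by fun_prop)
    refine Continuous.subtype_mk (continuous_pi fun a => ?_) _
    refine Continuous.div (by fun_prop) (by fun_prop) fun p h0 => ?_
    obtain ⟨-, s, -, -, h1⟩ :=
      blockTrack_mem_realization (v := v) hE hK i₀ p.1.1.1 p.1.2.1 p.1.2.2.1 p.1.2.2.2 p.2
    simp [h0] at h1
  have hzero : ∀ z : Z, h (z, 0) = z.1.1 := by
    intro z
    have htr : ∀ a, blockTrack E π v i₀ z.1.1.1 z.1.2 ((0 : unitInterval) : ℝ) a = z.1.1.1 a := by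
      intro a
      norm_num [blockTrack]
    refine Subtype.ext (funext fun a => ?_)
    simp only [h, htr, Realization.sum_eq_one hE, div_one]
  have hone : ∀ z : Z, (h (z, 1)).1 = fun a => (if v i₀ = a then 1 else 0 : ℝ) /
      ∑ b ∈ E, if v i₀ = b then 1 else 0 := by
    intro z
    have htr : ∀ a, blockTrack E π v i₀ z.1.1.1 z.1.2 ((1 : unitInterval) : ℝ) a =
        if v i₀ = a then 1 else 0 := by
      intro a
      norm_num [blockTrack]
    refine funext fun a => ?_
    simp only [h, htr]
  have hq := div_sum_mem_realization (K := K) (w := fun a => if v i₀ = a then (1 : ℝ) else 0)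
    (s := {v i₀}) (fun a => by split_ifs <;> norm_num)
    (by simpa using hK ∅ hne ∅ (by simp) {i₀} (by simp))
    (hE _ (by simpa using hK ∅ hne ∅ (by simp) {i₀} (by simp)))
    (fun a ha => by simpa [eq_comm] using ha) ⟨v i₀, by simp⟩
  let δ : ℝ := 1 / Fintype.card κ
  -- Complete a point of the small cube in `ℝ^κ` to a point of the simplex in `ℝ^ι`.
  let complete : (κ → ℝ) → ι → ℝ := fun c i => if hi : i = i₀ then 1 - ∑ j, c j else c ⟨i, hi⟩
  have hext : Continuous complete := continuous_pi fun i => by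
    by_cases hi : i = i₀ <;> simp only [complete, hi, dite_true, dite_false] <;> fun_prop
  have hgood : ∀ (x : Realization K) (c : κ → ℝ), (∀ j, 0 ≤ c j ∧ c j ≤ δ) →
      c ≠ (fun j => blockMass E π x.1 j.1) → (∀ i, 0 ≤ complete c i) ∧
      (∃ i, complete c i < blockMass E π x.1 i) ∧ ∃ i, blockMass E π x.1 i < complete c i := by
    intro x c hc hcx
    have hsum : ∑ i, complete c i = ∑ i, blockMass E π x.1 i := by
      rw [sum_blockMass, Realization.sum_eq_one hE, Fintype.sum_eq_add_sum_subtype_ne _ i₀]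
      have : ∀ j : κ, complete c j.1 = c j := fun j => by simp [complete, j.2]
      simp only [this, complete, dite_true]
      convert sub_add_cancel (1 : ℝ) (∑ j, c j)
    obtain ⟨j, hj⟩ := Function.ne_iff.1 hcx
    have hj' : complete c j.1 ≠ blockMass E π x.1 j.1 := by simpa [complete, j.2] using hj
    refine ⟨fun i => ?_, ?_, ?_⟩
    · by_cases hi : i = i₀
      · have : ∑ j, c j ≤ 1 := by
          refine (Finset.sum_le_sum fun j _ => (hc j).2).trans_eq ?_
          simp [δ, hκpos.ne']
        simp only [complete, hi, dite_true]
        linarith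
      · simpa only [complete, hi, dite_false] using (hc _).1
    · by_contra! hle
      exact hj' ((Finset.sum_eq_sum_iff_of_le fun i _ => hle i).1 hsum.symm _
        (Finset.mem_univ _)).symm
    · by_contra! hle
      exact hj' ((Finset.sum_eq_sum_iff_of_le fun i _ => hle i).1 hsum _ (Finset.mem_univ _))
  refine ⟨⟨⟨_, hq⟩⟩, fun ℓ hℓ x₀ => ?_⟩
  have hnull : ∀ f : GenLoop (Fin ℓ) (Realization K) x₀, GenLoop.Homotopic f GenLoop.const := by
    intro f
    have hfc : Continuous fun y => (f y).1 := continuous_subtype_val.comp f.1.continuous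
    obtain ⟨c, c₀, hc, hcγ, hc₀, hcc₀, hcδ, hc₀δ⟩ :=
      exists_continuous_ne_of_lt_card (κ := κ) (hℓ.trans_lt hκ)
      (fun y j => blockMass E π (f y).1 j.1) (by fun_prop)
      (fun j => blockMass E π x₀.1 j.1) (δ := δ) (by positivity)
    refine GenLoop.homotopic_const_of_deformation (q := ⟨_, hq⟩) f h hcont
      (fun y => ⟨(f y, complete (c y)), hgood _ _ (hcδ y) (hcγ y)⟩) ?_
      ⟨(x₀, complete c₀), hgood _ _ hc₀δ hc₀⟩ (fun y => hzero _) (hzero _) ?_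
      fun z => Subtype.ext (hone z)
    · exact Continuous.subtype_mk (f.1.continuous.prodMk (hext.comp hc)) _
    · intro y hy
      have hfy : f y = x₀ := f.2 y hy
      refine Subtype.ext (Prod.ext hfy ?_)
      simp only
      rw [hcc₀ y (by rw [hfy])]
  refine ⟨fun a b => ?_⟩
  induction a using Quotient.inductionOn with | _ f
  induction b using Quotient.inductionOn with | _ g
  exact Quotient.sound ((hnull f).trans (hnull g).symm)

end BlockConnected

/-- The index type of the vertical edges in the odd rows of the honeycomb graph. -/
abbrev HoneycombSite (r s t : ℕ) : Type :=
  {ab : Fin r × Fin s // (ab.1.val + ab.2.val) % 2 = 0} ⊕ (Fin t × Fin ((r + s) / 2))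

/-- The lower endpoint of the vertical edge indexed by a site. -/
def HoneycombSite.pos {r s t : ℕ} : HoneycombSite r s t → ℤ × ℤ
  | .inl ab => (2 * (t : ℤ) + ab.1.1.val - ab.1.2.val, (r : ℤ) + s - 2 - ab.1.1.val - ab.1.2.val)
  | .inr jq => (2 * (jq.2.val : ℤ) + 2 - 2 * min (2 * (jq.2.val : ℤ) + 1) s + 2 * jq.1.val,
      (r : ℤ) + s - 2 - 2 * jq.2.val)

/-- The vertical edge indexed by a site. -/
def HoneycombSite.edge {r s t : ℕ} (i : HoneycombSite r s t) : Sym2 (ℤ × ℤ) :=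
  s(i.pos, (i.pos.1, i.pos.2 + 1))

theorem HoneycombSite.pos_injective {r s t : ℕ} :
    Function.Injective (HoneycombSite.pos : HoneycombSite r s t → ℤ × ℤ) := by
  rintro (⟨⟨a, b⟩, hab⟩ | ⟨j, q⟩) (⟨⟨a', b'⟩, hab'⟩ | ⟨j', q'⟩) h <;>
    simp only [HoneycombSite.pos, Prod.mk.injEq] at h
  · have h1 : a = a' := Fin.ext (by lia)
    have h2 : b = b' := Fin.ext (by lia)
    subst h1 h2
    rfl
  · have := j'.2
    have := b.2
    omega
  · have := j.2
    have := b'.2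
    omega
  · have h1 : q = q' := Fin.ext (by lia)
    subst h1
    have h2 : j = j' := Fin.ext (by lia)
    rw [h2]

theorem HoneycombSite.pos_parity {r s t : ℕ} (i : HoneycombSite r s t) :
    i.pos.1 % 2 = 0 ∧ (i.pos.2 - r - s) % 2 = 0 := by
  rcases i with ⟨⟨a, b⟩, hab⟩ | ⟨j, q⟩ <;> simp only [HoneycombSite.pos]
  · simp only at hab
    lia
  · lia

theorem honeycomb_adj_vertical {r s t i j : ℕ} (hr : 1 ≤ r) (hs : 1 ≤ s) (ht : 1 ≤ t)
    (hi : 1 ≤ i) (hi' : i ≤ r + s - 1) (hj : j ≤ honeycombRho r s t i) {x y : ℤ}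
    (hx : x = honeycombOffset s i + 2 * j)
    (hy : y = r + s - 1 - i) : (honeycomb r s t).Adj (x, y) (x, y + 1) := by
  subst hx hy
  refine (SimpleGraph.fromRel_adj _ _ _).2 ⟨by simp, Or.inl ?_⟩
  rcases hj.lt_or_eq with hj | hj
  · exact ⟨i, j, hi, hi', hj, by simp [HexEdge]⟩
  · have hpos : 0 < honeycombRho r s t i := by
      unfold honeycombRho
      split_ifs <;> lia
    refine ⟨i, j - 1, hi, hi', by lia, ?_⟩
    iterate 5 right
    have : ((j - 1 : ℕ) : ℤ) = j - 1 := by lia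
    rw [this]
    simp only [Prod.mk.injEq, and_true]
    constructor <;> ring

theorem HoneycombSite.edge_mem_edgeSet {r s t : ℕ} (hr : 1 ≤ r) (hs : 1 ≤ s) (ht : 1 ≤ t)
    (i : HoneycombSite r s t) : i.edge ∈ (honeycomb r s t).edgeSet := by
  rcases i with ⟨⟨a, b⟩, hab⟩ | ⟨j, q⟩
  · have := a.2
    have := b.2
    refine honeycomb_adj_vertical hr hs ht (i := a.val + b.val + 1)
      (j := t + a.val - (a.val + b.val + 1 - s)) (by lia) (by lia) ?_ ?_ ?_
    · unfold honeycombRho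
      split_ifs <;> omega
    · simp only [honeycombOffset]
      lia
    · lia
  · have := j.2
    have := q.2
    refine honeycomb_adj_vertical hr hs ht (i := 2 * q.val + 1) (j := j.val) (by lia) (by lia) ?_ ?_ ?_
    · unfold honeycombRho
      split_ifs <;> omega
    · simp only [honeycombOffset]
      lia
    · lia

theorem exists_of_mem_edgeSet_honeycomb {r s t : ℕ} {e : Sym2 (ℤ × ℤ)}
    (he : e ∈ (honeycomb r s t).edgeSet) :
    ∃ i j : ℕ, 1 ≤ i ∧ i ≤ r + s - 1 ∧ j < honeycombRho r s t i ∧ ∃ p q, e = s(p, q) ∧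
      HexEdge (honeycombOffset s i + 2 * (j : ℤ)) ((r : ℤ) + (s : ℤ) - 1 - (i : ℤ)) p q := by
  induction e using Sym2.ind with | _ p q
  obtain ⟨-, ⟨i, j, h1, h2, h3, h4⟩ | ⟨i, j, h1, h2, h3, h4⟩⟩ :=
    (SimpleGraph.fromRel_adj _ _ _).1 ((SimpleGraph.mem_edgeSet _).1 he)
  · exact ⟨i, j, h1, h2, h3, p, q, rfl, h4⟩
  · exact ⟨i, j, h1, h2, h3, q, p, Sym2.eq_swap, h4⟩

theorem honeycomb_edge_horizontal_or_vertical {r s t : ℕ} {e : Sym2 (ℤ × ℤ)}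
    (he : e ∈ (honeycomb r s t).edgeSet) : ∃ x y : ℤ, e = s((x, y), (x + 1, y)) ∨
      e = s((x, y), (x, y + 1)) ∧ (x + y - r - s) % 2 = 0 := by
  obtain ⟨i, j, -, -, -, p, q, rfl, h⟩ := exists_of_mem_edgeSet_honeycomb he
  have hpar : (honeycombOffset s i + 2 * (j : ℤ) + ((r : ℤ) + (s : ℤ) - 1 - (i : ℤ)) - r - s) % 2
      = 0 := by
    unfold honeycombOffset
    lia
  rcases h with ⟨rfl, rfl⟩ | ⟨rfl, rfl⟩ | ⟨rfl, rfl⟩ | ⟨rfl, rfl⟩ | ⟨rfl, rfl⟩ | ⟨rfl, rfl⟩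
  · exact ⟨_, _, .inl rfl⟩
  · exact ⟨_, _, .inl (by rw [add_assoc _ 1 1]; rfl)⟩
  · exact ⟨_, _, .inl rfl⟩
  · exact ⟨_, _, .inl (by rw [add_assoc _ 1 1]; rfl)⟩
  · exact ⟨_, _, .inr ⟨rfl, hpar⟩⟩
  · exact ⟨_, _, .inr ⟨rfl, by lia⟩⟩

theorem HoneycombSite.eq_of_edgeIncident {r s t : ℕ} {e : Sym2 (ℤ × ℤ)}
    (he : e ∈ (honeycomb r s t).edgeSet) {i j : HoneycombSite r s t}
    (hi : EdgeIncident e i.edge) (hj : EdgeIncident e j.edge) : i = j := by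
  apply HoneycombSite.pos_injective
  have hpi := i.pos_parity
  have hpj := j.pos_parity
  obtain ⟨u, hue, hui⟩ := hi
  obtain ⟨w, hwe, hwj⟩ := hj
  simp only [HoneycombSite.edge, Sym2.mem_iff] at hui hwj
  generalize i.pos = P at *
  generalize j.pos = Q at *
  obtain ⟨P₁, P₂⟩ := P
  obtain ⟨Q₁, Q₂⟩ := Q
  obtain ⟨u₁, u₂⟩ := u
  obtain ⟨w₁, w₂⟩ := w
  obtain ⟨x, y, rfl | ⟨rfl, hxy⟩⟩ := honeycomb_edge_horizontal_or_vertical he <;>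
    simp only [Sym2.mem_iff, Prod.mk.injEq] at * <;> omega

theorem finite_edgeSet_honeycomb (r s t : ℕ) : (honeycomb r s t).edgeSet.Finite := by
  let B : ℤ := 4 * (r + s + t) + 4
  have hB : (Set.Icc (-B, -B) (B, B)).Finite := Set.finite_Icc _ _
  refine ((hB.prod hB).image fun p => s(p.1, p.2)).subset fun e he => ?_
  obtain ⟨i, j, hi, hi', hj, p, q, rfl, h⟩ := exists_of_mem_edgeSet_honeycomb he
  have hj' : (j : ℤ) < t + r + s := by
    unfold honeycombRho at hj
    split_ifs at hj <;> omega
  have hx : -(i : ℤ) ≤ honeycombOffset s i ∧ honeycombOffset s i ≤ i + 1 := by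
    unfold honeycombOffset
    lia
  refine ⟨(p, q), ?_, rfl⟩
  obtain ⟨p₁, p₂⟩ := p
  obtain ⟨q₁, q₂⟩ := q
  simp only [HexEdge, Prod.mk.injEq, Set.mem_prod, Set.mem_Icc, Prod.mk_le_mk, B] at h ⊢
  omega

theorem card_even_add (r s : ℕ) :
    Fintype.card {ab : Fin r × Fin s // (ab.1.val + ab.2.val) % 2 = 0} = (r * s + 1) / 2 := by
  have inner : ∀ a s : ℕ, ∑ b ∈ Finset.range s, (if (a + b) % 2 = 0 then 1 else 0) =
      (s + (a + 1) % 2) / 2 := by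
    intro a s
    induction s with
    | zero => simp
    | succ s ih =>
      rw [Finset.sum_range_succ, ih]
      split_ifs <;> lia
  have outer : ∑ a ∈ Finset.range r, (s + (a + 1) % 2) / 2 = (r * s + 1) / 2 := by
    induction r with
    | zero => simp
    | succ r ih =>
      rw [Finset.sum_range_succ, ih, add_mul, one_mul]
      obtain ⟨k, rfl | rfl⟩ := Nat.even_or_odd' r
      · rw [mul_assoc]
        lia
      · rw [add_mul, mul_assoc, one_mul]
        lia
  rw [Fintype.card_subtype, Finset.card_filter, Fintype.sum_prod_type, ← outer,
    ← Fin.sum_univ_eq_sum_range (fun a => (s + (a + 1) % 2) / 2)]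
  refine Finset.sum_congr rfl fun a _ => ?_
  rw [← inner, ← Fin.sum_univ_eq_sum_range (fun b => if (a.val + b) % 2 = 0 then 1 else 0)]

/-- The matching complex of the `r × s × t` honeycomb graph is at least
`k`-connected, where `k = t·⌈(r+s−1)/2⌉ + ⌈max(r,s)·min(r,s)/2⌉ − 2`. -/
theorem matchingComplex_honeycomb_connected (r s t : ℕ)
    (hr : 1 ≤ r) (hs : 1 ≤ s) (ht : 1 ≤ t) :
    IsNConnectedSpace
      (t * ((r + s - 1 + 1) / 2) + (Nat.max r s * Nat.min r s + 1) / 2 - 2)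
      (Realization (matchingComplex (honeycomb r s t))) := by
  classical
  have hcard : Fintype.card (HoneycombSite r s t) = (r * s + 1) / 2 + t * ((r + s) / 2) := by
    rw [Fintype.card_sum, card_even_add, Fintype.card_prod, Fintype.card_fin, Fintype.card_fin]
  have hrs : 1 ≤ r * s := Nat.mul_pos hr hs
  have htrs : 1 ≤ t * ((r + s) / 2) := Nat.mul_pos ht (by lia)
  have : Nonempty (HoneycombSite r s t) := Fintype.card_pos_iff.1 (by lia)
  let π : Sym2 (ℤ × ℤ) → HoneycombSite r s t := fun e => Classical.epsilon fun i =>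
    EdgeIncident e i.edge
  have hπ : ∀ e ∈ (honeycomb r s t).edgeSet, ∀ i : HoneycombSite r s t,
      EdgeIncident e i.edge → π e = i := fun e he i hi =>
    HoneycombSite.eq_of_edgeIncident he
      (Classical.epsilon_spec (p := fun i : HoneycombSite r s t => EdgeIncident e i.edge) ⟨i, hi⟩) hi
  have hsymm : ∀ e f : Sym2 (ℤ × ℤ), EdgeIncident e f → EdgeIncident f e :=
    fun e f ⟨u, he, hf⟩ => ⟨u, hf, he⟩
  refine isNConnectedSpace_realization_of_blocks (E := (finite_edgeSet_honeycomb r s t).toFinset)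
    (π := π) (v := HoneycombSite.edge) (by simp [matchingComplex])
    (fun m hm e he => by simpa using hm.1 e he) ?_ ?_
  · rintro m ⟨hmG, hm⟩ m' hm' A hA
    refine ⟨fun e he => ?_, fun e he f hf hef hinc => ?_⟩
    · rcases Finset.mem_union.1 he with he | he
      · exact hmG e (hm' he)
      · obtain ⟨i, -, rfl⟩ := Finset.mem_image.1 he
        exact i.edge_mem_edgeSet hr hs ht
    · rcases Finset.mem_union.1 he with he | he <;> rcases Finset.mem_union.1 hf with hf | hf
      · exact hm (hm' he) (hm' hf) hef hinc
      · obtain ⟨i, hi, rfl⟩ := Finset.mem_image.1 hf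
        exact hA e he (hπ e (hmG e (hm' he)) i hinc ▸ hi)
      · obtain ⟨i, hi, rfl⟩ := Finset.mem_image.1 he
        exact hA f hf (hπ f (hmG f (hm' hf)) i (hsymm _ _ hinc) ▸ hi)
      · obtain ⟨i, -, rfl⟩ := Finset.mem_image.1 he
        obtain ⟨j, -, rfl⟩ := Finset.mem_image.1 hf
        have hself : EdgeIncident i.edge i.edge := ⟨i.pos, by simp [HoneycombSite.edge]⟩
        exact hef (congrArg _ (HoneycombSite.eq_of_edgeIncident (i.edge_mem_edgeSet hr hs ht)
          hself hinc))
  · have hmul : Nat.max r s * Nat.min r s = r * s := max_mul_min r s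
    have hsub : r + s - 1 + 1 = r + s := by lia
    rw [hcard, hmul, hsub]
    lia
end
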